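/- Let α ∈ (0,1/2) and let X₁,…,Xₙ be integrable, each non-degenerate, and set xᵢ = ex_α(Xᵢ). Define f : (0,∞)ⁿ → ℝ by f(w) = DQ^ex_α(w₁X₁,…,wₙXₙ). Assume that for every w ∈ (0,∞)ⁿ the map A : ℝⁿ → ℝ, A(u) = E[(Σᵢ uᵢ(Xᵢ − xᵢ))₊], is Fréchet differentiable at w with derivative the linear map u ↦ E[(Σᵢ uᵢ(Xᵢ − xᵢ))·1_{Σᵢ wᵢ(Xᵢ − xᵢ) > 0}]. Then f is differentiable on (0,∞)ⁿ, Df(w)(w) = 0 for every w ∈ (0,∞)ⁿ, and f is pseudo-convex on (0,∞)ⁿ: for all w, v ∈ (0,∞)ⁿ, f(v) < f(w) implies Df(w)(v − w) < 0. -/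

import Mathlib

open MeasureTheory

variable {Ω : Type*} [MeasurableSpace Ω]

/-- `t` is the `α`-expectile of `X` under `P`:
`(1−α)·E[(X−t)₊] = α·E[(X−t)₋]`. -/
def IsExpectile (P : Measure Ω) (α : ℝ) (X : Ω → ℝ) (t : ℝ) : Prop :=
  (1 - α) * ∫ ω, max (X ω - t) 0 ∂P = α * ∫ ω, max (t - X ω) 0 ∂P

/-- The expectile-based diversification quotient `DQ^ex_α(X₁,…,Xₙ) = α*/α`, where
`α* = inf {β ∈ (0,1) : ex_β(∑ᵢ Xᵢ) ≤ ∑ᵢ ex_α(Xᵢ)}` with the convention `inf ∅ = 1`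
(implemented by adjoining `1` to the set, which does not change a nonempty infimum since
the set, when nonempty, has infimum at most `1`). Here `ex` is the expectile functional. -/
noncomputable def DQex (P : Measure Ω) (ex : ℝ → (Ω → ℝ) → ℝ) (α : ℝ)
    {n : ℕ} (X : Fin n → Ω → ℝ) : ℝ :=
  sInf ({β : ℝ | β ∈ Set.Ioo (0:ℝ) 1 ∧
      ex β (fun ω => ∑ i, X i ω) ≤ ∑ i, ex α (X i)} ∪ {1}) / α

lemma phi_gap {b y z : ℝ} (h0 : 0 < b) (h1 : b < 1) (h : z ≤ y) :
    b * (1 - b) * (y - z) ≤ ((1 - b) * max y 0 - b * max (-y) 0)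
      - ((1 - b) * max z 0 - b * max (-z) 0) := by
  have hbb : b * (1 - b) ≤ b := by nlinarith
  have hbb' : b * (1 - b) ≤ 1 - b := by nlinarith
  rcases le_total 0 y with hy | hy <;> rcases le_total 0 z with hz | hz
  · rw [max_eq_left hy, max_eq_left hz, max_eq_right (by linarith), max_eq_right (by linarith)]
    nlinarith [mul_nonneg (sub_nonneg.2 hbb') (sub_nonneg.2 h)]
  · rw [max_eq_left hy, max_eq_right hz, max_eq_right (by linarith), max_eq_left (by linarith)]
    nlinarith [mul_nonneg (sub_nonneg.2 hbb') hy, mul_nonneg (sub_nonneg.2 hbb) (neg_nonneg.2 hz)]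
  · have : y = z := by linarith
    subst this; simp
  · rw [max_eq_right hy, max_eq_right hz, max_eq_left (by linarith), max_eq_left (by linarith)]
    nlinarith [mul_nonneg (sub_nonneg.2 hbb) (sub_nonneg.2 h)]

lemma expectile_gap (P : Measure Ω) [IsProbabilityMeasure P] {b : ℝ} (h0 : 0 < b) (h1 : b < 1)
    {Y : Ω → ℝ} (hY : Integrable Y P) {s t : ℝ} (h : s ≤ t) :
    b * (1 - b) * (t - s) ≤ ((1 - b) * ∫ ω, max (Y ω - s) 0 ∂P - b * ∫ ω, max (s - Y ω) 0 ∂P)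
      - ((1 - b) * ∫ ω, max (Y ω - t) 0 ∂P - b * ∫ ω, max (t - Y ω) 0 ∂P) := by
  have i1 : ∀ r : ℝ, Integrable (fun ω => max (Y ω - r) 0) P := fun r =>
    (hY.sub (integrable_const r)).pos_part
  have i2 : ∀ r : ℝ, Integrable (fun ω => max (r - Y ω) 0) P := fun r =>
    ((integrable_const r).sub hY).pos_part
  have e : ∀ r : ℝ, ((1 - b) * ∫ ω, max (Y ω - r) 0 ∂P - b * ∫ ω, max (r - Y ω) 0 ∂P)
      = ∫ ω, ((1 - b) * max (Y ω - r) 0 - b * max (r - Y ω) 0) ∂P := by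
    intro r
    rw [integral_sub ((i1 r).const_mul _) ((i2 r).const_mul _), integral_const_mul,
      integral_const_mul]
  have i3 : ∀ r : ℝ, Integrable (fun ω => (1 - b) * max (Y ω - r) 0 - b * max (r - Y ω) 0) P :=
    fun r => ((i1 r).const_mul _).sub ((i2 r).const_mul _)
  rw [e, e, ← integral_sub (i3 s) (i3 t)]
  have : b * (1 - b) * (t - s) = ∫ _ω, b * (1 - b) * (t - s) ∂P := by simp
  rw [this]
  refine integral_mono (integrable_const _) ((i3 s).sub (i3 t)) fun ω => ?_
  have := phi_gap (y := Y ω - s) (z := Y ω - t) h0 h1 (by linarith)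
  simp only [neg_sub] at this
  have e2 : (Y ω - s) - (Y ω - t) = t - s := by ring
  rw [e2] at this
  exact this

lemma expectile_le_iff (P : Measure Ω) [IsProbabilityMeasure P] {b : ℝ} (h0 : 0 < b) (h1 : b < 1)
    {Y : Ω → ℝ} (hY : Integrable Y P) {e t : ℝ} (he : IsExpectile P b Y e) :
    e ≤ t ↔ (1 - b) * ∫ ω, max (Y ω - t) 0 ∂P ≤ b * ∫ ω, max (t - Y ω) 0 ∂P := by
  unfold IsExpectile at he
  have hp : 0 < b * (1 - b) := mul_pos h0 (by linarith)
  constructor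
  · intro h
    have := expectile_gap P h0 h1 hY h
    nlinarith [mul_nonneg hp.le (sub_nonneg.2 h)]
  · intro h
    by_contra hc
    push Not at hc
    have := expectile_gap P h0 h1 hY hc.le
    nlinarith [mul_pos hp (sub_pos.2 hc)]

lemma expectile_unique (P : Measure Ω) [IsProbabilityMeasure P] {b : ℝ} (h0 : 0 < b) (h1 : b < 1)
    {Y : Ω → ℝ} (hY : Integrable Y P) {e t : ℝ} (he : IsExpectile P b Y e)
    (ht : IsExpectile P b Y t) : e = t :=
  le_antisymm ((expectile_le_iff P h0 h1 hY he).2 (le_of_eq ht))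
    ((expectile_le_iff P h0 h1 hY ht).2 (le_of_eq he))

lemma expectile_smul (P : Measure Ω) {b : ℝ} {Y : Ω → ℝ} {t c : ℝ} (hc : 0 < c)
    (ht : IsExpectile P b Y t) : IsExpectile P b (fun ω => c * Y ω) (c * t) := by
  unfold IsExpectile at *
  have e1 : ∀ ω, max (c * Y ω - c * t) 0 = c * max (Y ω - t) 0 := by
    intro ω; rw [mul_max_of_nonneg _ _ hc.le]; ring_nf
  have e2 : ∀ ω, max (c * t - c * Y ω) 0 = c * max (t - Y ω) 0 := by
    intro ω; rw [mul_max_of_nonneg _ _ hc.le]; ring_nf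
  simp only [e1, e2, integral_const_mul]
  linear_combination c * ht

lemma sInf_aux {a b : ℝ} (ha : 0 ≤ a) (hb : 0 < b) (S : Set ℝ)
    (hS : ∀ β, β ∈ S ↔ β ∈ Set.Ioo (0:ℝ) 1 ∧ (1 - β) * a ≤ β * b) :
    sInf (S ∪ {1}) = a / (a + b) := by
  have hab : 0 < a + b := by linarith
  have key : ∀ β ∈ S ∪ {1}, a / (a + b) ≤ β := by
    rintro β (h | h)
    · rw [div_le_iff₀ hab]; nlinarith [((hS β).1 h).2]
    · rw [Set.mem_singleton_iff.1 h, div_le_one hab]; linarith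
  refine le_antisymm ?_ (le_csInf ⟨1, Or.inr rfl⟩ key)
  refine le_of_forall_gt_imp_ge_of_dense fun c hc => ?_
  have hbd : BddBelow (S ∪ {1}) := ⟨_, key⟩
  by_cases h1 : c < 1
  · refine csInf_le hbd (Or.inl ((hS c).2 ⟨⟨lt_of_le_of_lt (by positivity) hc, h1⟩, ?_⟩))
    rw [div_lt_iff₀ hab] at hc
    nlinarith
  · exact (csInf_le hbd (Or.inr rfl)).trans (not_lt.1 h1)

lemma mean_neg (P : Measure Ω) [IsProbabilityMeasure P] {b : ℝ} (h0 : 0 < b) (h1 : b < 1/2)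
    {Y : Ω → ℝ} (hY : Integrable Y P) (hnd : ¬ ∃ c : ℝ, ∀ᵐ ω ∂P, Y ω = c) {t : ℝ}
    (ht : IsExpectile P b Y t) : ∫ ω, (Y ω - t) ∂P < 0 := by
  have i1 : Integrable (fun ω => max (Y ω - t) 0) P := (hY.sub (integrable_const t)).pos_part
  have i2 : Integrable (fun ω => max (t - Y ω) 0) P := ((integrable_const t).sub hY).pos_part
  have e : ∫ ω, (Y ω - t) ∂P = ∫ ω, max (Y ω - t) 0 ∂P - ∫ ω, max (t - Y ω) 0 ∂P := by
    rw [← integral_sub i1 i2]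
    congr 1; ext ω
    rcases le_total (Y ω) t with h | h
    · rw [max_eq_right (by linarith), max_eq_left (by linarith)]; ring
    · rw [max_eq_left (by linarith), max_eq_right (by linarith)]; ring
  unfold IsExpectile at ht
  have n1 : 0 ≤ ∫ ω, max (Y ω - t) 0 ∂P := integral_nonneg fun ω => le_max_right _ _
  have n2 : 0 ≤ ∫ ω, max (t - Y ω) 0 ∂P := integral_nonneg fun ω => le_max_right _ _
  have n3 : 0 < ∫ ω, max (t - Y ω) 0 ∂P := by
    refine lt_of_le_of_ne n2 fun hz => hnd ⟨t, ?_⟩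
    rw [← hz] at ht
    have hz1 : ∫ ω, max (Y ω - t) 0 ∂P = 0 := by
      rcases mul_eq_zero.1 (ht.trans (mul_zero _)) with h | h
      · linarith
      · exact h
    have a1 := (integral_eq_zero_iff_of_nonneg (fun ω => le_max_right _ _) i1).1 hz1
    have a2 := (integral_eq_zero_iff_of_nonneg (fun ω => le_max_right _ _) i2).1 hz.symm
    filter_upwards [a1, a2] with ω h1 h2
    have g1 : max (Y ω - t) 0 = 0 := h1
    have g2 : max (t - Y ω) 0 = 0 := h2
    linarith [max_eq_right_iff.1 g1, max_eq_right_iff.1 g2]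
  rw [e]
  nlinarith

/-- pseudo-convexity of w ↦ DQ^ex_α(w ⊙ X) on (0,∞)ⁿ, under the assumed
differentiability of the upper-partial-moment map A, with derivative D f satisfying
D f(w)(w) = 0 and f(v) < f(w) → D f(w)(v − w) < 0. -/
theorem stmt9
    (P : Measure Ω) [IsProbabilityMeasure P]
    (α : ℝ) (hα : α ∈ Set.Ioo (0:ℝ) (1/2))
    {n : ℕ} (X : Fin n → Ω → ℝ) (hX : ∀ i, Integrable (X i) P)
    (hXnd : ∀ i, ¬ ∃ c : ℝ, ∀ᵐ ω ∂P, X i ω = c)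
    (ex : ℝ → (Ω → ℝ) → ℝ)
    (hex : ∀ β ∈ Set.Ioo (0:ℝ) 1, ∀ Y : Ω → ℝ, Integrable Y P → IsExpectile P β Y (ex β Y))
    (x : Fin n → ℝ) (hx : ∀ i, x i = ex α (X i))
    (A : (Fin n → ℝ) → ℝ)
    (hA : ∀ u, A u = ∫ ω, max (∑ i, u i * (X i ω - x i)) 0 ∂P)
    (L : (Fin n → ℝ) → (Fin n → ℝ) →L[ℝ] ℝ)
    (hL : ∀ w : Fin n → ℝ, (∀ i, 0 < w i) → HasFDerivAt A (L w) w)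
    (hLval : ∀ w : Fin n → ℝ, (∀ i, 0 < w i) → ∀ u : Fin n → ℝ,
      L w u = ∫ ω in {ω' | 0 < ∑ i, w i * (X i ω' - x i)},
        (∑ i, u i * (X i ω - x i)) ∂P)
    (f : (Fin n → ℝ) → ℝ)
    (hf : ∀ w, f w = DQex P ex α (fun i ω => w i * X i ω)) :
    ∃ D : (Fin n → ℝ) → (Fin n → ℝ) →L[ℝ] ℝ,
      (∀ w : Fin n → ℝ, (∀ i, 0 < w i) → HasFDerivAt f (D w) w) ∧
      (∀ w : Fin n → ℝ, (∀ i, 0 < w i) → D w w = 0) ∧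
      (∀ w v : Fin n → ℝ, (∀ i, 0 < w i) → (∀ i, 0 < v i) →
        f v < f w → D w (v - w) < 0) := by
  obtain ⟨hα0, hα1⟩ := hα
  have hα2 : α < 1 := by linarith
  rcases isEmpty_or_nonempty (Fin n) with hn | hn
  · refine ⟨fun _ => 0, fun w _ => hasFDerivAt_of_subsingleton f w, fun _ _ => rfl, ?_⟩
    intro w v _ _ h
    rw [Subsingleton.elim v w] at h
    exact absurd h (lt_irrefl _)
  have hxe : ∀ i, IsExpectile P α (X i) (x i) := fun i => by
    rw [hx i]; exact hex α ⟨hα0, hα2⟩ _ (hX i)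
  have hint : ∀ u : Fin n → ℝ, Integrable (fun ω => ∑ i, u i * (X i ω - x i)) P := fun u =>
    integrable_finsetSum _ fun i _ => ((hX i).sub (integrable_const _)).const_mul _
  let m : (Fin n → ℝ) →L[ℝ] ℝ :=
    ∑ i, (∫ ω, (X i ω - x i) ∂P) • ContinuousLinearMap.proj (R := ℝ) (φ := fun _ : Fin n => ℝ) i
  have hmv : ∀ u, m u = ∑ i, (∫ ω, (X i ω - x i) ∂P) * u i := fun u => by
    simp [m]
  have hmi : ∀ u, m u = ∫ ω, (∑ i, u i * (X i ω - x i)) ∂P := fun u => by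
    have hi : ∀ i ∈ Finset.univ, Integrable (fun ω => u i * (X i ω - x i)) P := fun i _ =>
      ((hX i).sub (integrable_const (x i))).const_mul (u i)
    rw [hmv, integral_finsetSum _ hi]
    refine Finset.sum_congr rfl fun i _ => ?_
    rw [integral_const_mul, mul_comm]
  have hmneg : ∀ w : Fin n → ℝ, (∀ i, 0 < w i) → m w < 0 := fun w hw => by
    rw [hmv]
    exact Finset.sum_neg (fun i _ => mul_neg_of_neg_of_pos
      (mean_neg P hα0 hα1 (hX i) (hXnd i) (hxe i)) (hw i)) Finset.univ_nonempty
  have hA0 : ∀ u, 0 ≤ A u := fun u => by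
    rw [hA]; exact integral_nonneg fun ω => le_max_right _ _
  have hB : ∀ u, ∫ ω, max (-(∑ i, u i * (X i ω - x i))) 0 ∂P = A u - m u := fun u => by
    rw [hA, hmi, ← integral_sub (hint u).pos_part (hint u)]
    congr 1; ext ω
    rcases le_total (∑ i, u i * (X i ω - x i)) 0 with h | h
    · rw [max_eq_right h, max_eq_left (by linarith)]; ring
    · rw [max_eq_left h, max_eq_right (by linarith)]; ring
  have hfv : ∀ w : Fin n → ℝ, (∀ i, 0 < w i) → f w = A w / (2 * A w - m w) / α := by
    intro w hw
    rw [hf, DQex]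
    congr 1
    have := hmneg w hw
    have := hA0 w
    rw [show 2 * A w - m w = A w + (A w - m w) by ring]
    refine sInf_aux (hA0 w) (by linarith) _ fun β => ?_
    refine and_congr_right fun hβ => ?_
    have hsum : ∑ i, ex α (fun ω => w i * X i ω) = ∑ i, w i * x i :=
      Finset.sum_congr rfl fun i _ => expectile_unique P hα0 hα2 ((hX i).const_mul _)
        (hex α ⟨hα0, hα2⟩ _ ((hX i).const_mul _)) (expectile_smul P (hw i) (hxe i))
    have hiY : Integrable (fun ω => ∑ i, w i * X i ω) P :=
      integrable_finsetSum _ fun i _ => (hX i).const_mul _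
    rw [hsum, expectile_le_iff P hβ.1 hβ.2 hiY (hex β hβ _ hiY), ← hB, hA]
    have e : ∀ ω, ∑ i, w i * (X i ω - x i) = ∑ i, w i * X i ω - ∑ i, w i * x i := fun ω => by
      simp [mul_sub]
    simp only [e, neg_sub]
  have hLle : ∀ w : Fin n → ℝ, (∀ i, 0 < w i) → ∀ u, L w u ≤ A u := by
    intro w hw u
    rw [hLval w hw, hA]
    refine (integral_mono (hint u).integrableOn (hint u).pos_part.integrableOn
      fun ω => le_max_left _ _).trans ?_
    exact setIntegral_le_integral (hint u).pos_part (ae_of_all _ fun ω => le_max_right _ _)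
  have hLw : ∀ w : Fin n → ℝ, (∀ i, 0 < w i) → L w w = A w := by
    intro w hw
    have hs : NullMeasurableSet {ω' | 0 < ∑ i, w i * (X i ω' - x i)} P :=
      nullMeasurableSet_lt aemeasurable_const (hint w).aemeasurable
    rw [hLval w hw, hA, ← integral_indicator₀ hs]
    congr 1; ext ω
    by_cases h : 0 < ∑ i, w i * (X i ω - x i)
    · rw [Set.indicator_of_mem (by exact h), max_eq_left h.le]
    · rw [Set.indicator_of_notMem (by exact h), max_eq_right (not_lt.1 h)]
  have hpos : ∀ w : Fin n → ℝ, (∀ i, 0 < w i) → 0 < 2 * A w - m w := fun w hw => by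
    linarith [hmneg w hw, hA0 w]
  refine ⟨fun w => (α * (2 * A w - m w) ^ 2)⁻¹ • ((-m w) • L w + A w • m), ?_, ?_, ?_⟩
  · intro w hw
    have h1 := hL w hw
    have h2 : HasFDerivAt (fun u => 2 * A u - m u) ((2:ℝ) • L w - m) w :=
      (h1.const_mul 2).sub m.hasFDerivAt
    have hp := hpos w hw
    have h3 := (h1.mul ((hasDerivAt_inv hp.ne').comp_hasFDerivAt w h2)).const_mul α⁻¹
    have hev : f =ᶠ[nhds w] fun u => α⁻¹ * (A u * (2 * A u - m u)⁻¹) := by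
      have ho : IsOpen {u : Fin n → ℝ | ∀ i, 0 < u i} := by
        simp only [Set.setOf_forall]
        exact isOpen_iInter_of_finite fun i => isOpen_lt continuous_const (continuous_apply i)
      filter_upwards [ho.mem_nhds hw] with u hu
      rw [hfv u hu, div_eq_inv_mul, div_eq_mul_inv]
    refine (h3.congr_of_eventuallyEq hev).congr_fderiv ?_
    ext1 u
    simp
    field_simp
    ring
  · intro w hw
    simp [hLw w hw]
    ring
  · intro w v hw hv h
    rw [hfv v hv, hfv w hw, div_lt_div_iff_of_pos_right hα0,
      div_lt_div_iff₀ (hpos v hv) (hpos w hw)] at h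
    have hp : 0 < (α * (2 * A w - m w) ^ 2)⁻¹ := by
      have := hpos w hw
      positivity
    simp only [smul_apply, add_apply, smul_eq_mul]
    rw [map_sub, map_sub, hLw w hw]
    refine mul_neg_of_pos_of_neg hp ?_
    nlinarith [mul_le_mul_of_nonneg_left (hLle w hw v) (neg_pos.2 (hmneg w hw)).le]
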